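/- Harmonic factorization theorem: for any harmonic homogeneous polynomial h of degree kn on ℝ³ there exist harmonic polynomials h₁,...,h_k each of degree n such that h = h₁ ∗ ... ∗ h_k. -/

import Mathlib

open MvPolynomial

/-- The quadratic form `q(x,y,z) = x² + y² + z²`. -/
noncomputable def qForm : MvPolynomial (Fin 3) ℝ := ∑ i : Fin 3, X i ^ 2

/-- The Laplacian of a polynomial on `ℝ³`. -/
noncomputable def lap (p : MvPolynomial (Fin 3) ℝ) : MvPolynomial (Fin 3) ℝ :=
  ∑ i : Fin 3, pderiv i (pderiv i p)

/-- A polynomial is harmonic if its Laplacian vanishes. -/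
def Harmonic (p : MvPolynomial (Fin 3) ℝ) : Prop := lap p = 0

/-- `star` is a harmonic product: on harmonic polynomials, `star h₁ h₂` is the harmonic
projection `(h₁h₂)₀` of the ordinary product. -/
def IsHarmonicProduct (star : MvPolynomial (Fin 3) ℝ → MvPolynomial (Fin 3) ℝ →
    MvPolynomial (Fin 3) ℝ) : Prop :=
  ∀ h₁ h₂, Harmonic h₁ → Harmonic h₂ →
    Harmonic (star h₁ h₂) ∧ ∃ g, h₁ * h₂ - star h₁ h₂ = qForm * g

lemma lap_C_mul (c : ℝ) (p : MvPolynomial (Fin 3) ℝ) : lap (C c * p) = C c * lap p := by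
  simp [lap, Finset.mul_sum]

lemma Harmonic.sub {p p' : MvPolynomial (Fin 3) ℝ} (hp : Harmonic p) (hp' : Harmonic p') :
    Harmonic (p - p') := by
  unfold Harmonic lap at *
  simp only [map_sub, Finset.sum_sub_distrib, hp, hp', sub_zero]

lemma Harmonic.C_mul {p : MvPolynomial (Fin 3) ℝ} (hp : Harmonic p) (c : ℝ) :
    Harmonic (C c * p) := by
  unfold Harmonic at *
  rw [lap_C_mul, hp, mul_zero]

lemma harmonic_one : Harmonic 1 := by
  simp [Harmonic, lap]

lemma isHomogeneous_lap {p : MvPolynomial (Fin 3) ℝ} {n : ℕ} (hp : p.IsHomogeneous n) :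
    (lap p).IsHomogeneous (n - 1 - 1) :=
  IsHomogeneous.sum _ _ _ fun _ _ => hp.pderiv.pderiv

lemma isHomogeneous_qForm : qForm.IsHomogeneous 2 :=
  IsHomogeneous.sum _ _ _ fun i _ => isHomogeneous_X_pow i 2

lemma qForm_ne_zero : qForm ≠ 0 := by
  intro h
  have := congrArg (eval fun _ => (1 : ℝ)) h
  norm_num [qForm] at this

lemma coeff_lap (p : MvPolynomial (Fin 3) ℝ) (m : Fin 3 →₀ ℕ) :
    coeff m (lap p) = ∑ i : Fin 3, coeff (m + Finsupp.single i 1 + Finsupp.single i 1) p *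
      ((m + Finsupp.single i 1 : Fin 3 →₀ ℕ) i + 1) * (m i + 1) := by
  simp only [lap, coeff_sum, coeff_pderiv]

lemma Harmonic.homogeneousComponent {p : MvPolynomial (Fin 3) ℝ} (hp : Harmonic p) (d : ℕ) :
    Harmonic (homogeneousComponent d p) := by
  ext m
  have hm : coeff m (lap p) = 0 := by rw [hp, coeff_zero]
  rw [coeff_lap] at hm ⊢
  simp only [coeff_homogeneousComponent, map_add, Finsupp.degree_single]
  split_ifs
  · rw [hm, coeff_zero]
  · simp

section HomogeneousComponent

variable {σ R : Type*} [CommSemiring R]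

lemma homogeneousComponent_mul_add {a : ℕ} {p : MvPolynomial σ R} (hp : p.IsHomogeneous a)
    (g : MvPolynomial σ R) (d : ℕ) :
    homogeneousComponent (a + d) (p * g) = p * homogeneousComponent d g := by
  induction g using MvPolynomial.induction_on' with
  | monomial m c =>
    rw [homogeneousComponent_of_mem (hp.mul (isHomogeneous_monomial c rfl)),
      homogeneousComponent_of_mem (isHomogeneous_monomial c rfl)]
    simp
  | add g g' ih ih' => rw [mul_add, map_add, map_add, ih, ih', mul_add]

lemma homogeneousComponent_mul_of_lt {a : ℕ} {p : MvPolynomial σ R} (hp : p.IsHomogeneous a)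
    (g : MvPolynomial σ R) {d : ℕ} (hd : d < a) :
    homogeneousComponent d (p * g) = 0 := by
  induction g using MvPolynomial.induction_on' with
  | monomial m c =>
    rw [homogeneousComponent_of_mem (hp.mul (isHomogeneous_monomial c rfl)), if_neg (by omega)]
  | add g g' ih ih' => rw [mul_add, map_add, ih, ih', add_zero]

end HomogeneousComponent

lemma qForm_dvd_homogeneousComponent {p : MvPolynomial (Fin 3) ℝ} (hp : qForm ∣ p) (d : ℕ) :
    qForm ∣ homogeneousComponent d p := by
  obtain ⟨g, rfl⟩ := hp
  rcases lt_or_ge d 2 with hd | hd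
  · rw [homogeneousComponent_mul_of_lt isHomogeneous_qForm g hd]
    exact dvd_zero _
  · obtain ⟨e, rfl⟩ := Nat.exists_eq_add_of_le hd
    rw [homogeneousComponent_mul_add isHomogeneous_qForm]
    exact dvd_mul_right _ _

lemma lap_qForm_mul {g : MvPolynomial (Fin 3) ℝ} {d : ℕ} (hg : g.IsHomogeneous d) :
    lap (qForm * g) = C (4 * d + 6 : ℝ) * g + qForm * lap g := by
  have he := hg.sum_X_mul_pderiv
  simp only [Fin.sum_univ_three, nsmul_eq_mul] at he
  have hC : (C (4 * d + 6 : ℝ) : MvPolynomial (Fin 3) ℝ) =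
      4 * (d : MvPolynomial (Fin 3) ℝ) + 6 := by
    simp [← map_ofNat (C : ℝ →+* MvPolynomial (Fin 3) ℝ)]
  rw [hC]
  simp only [lap, qForm, Fin.sum_univ_three, pow_two, pderiv_mul, map_add, pderiv_X,
    Pi.single_apply]
  simp
  linear_combination (4 : MvPolynomial (Fin 3) ℝ) * he

lemma lap_qForm_pow_mul {g : MvPolynomial (Fin 3) ℝ} {d : ℕ} (hg : g.IsHomogeneous d) (j : ℕ) :
    ∃ c : ℝ, 0 < c ∧ lap (qForm ^ (j + 1) * g) = C c * (qForm ^ j * g) +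
      qForm ^ (j + 1) * lap g := by
  induction j with
  | zero =>
    refine ⟨4 * d + 6, by positivity, ?_⟩
    simpa using lap_qForm_mul hg
  | succ j ih =>
    obtain ⟨c, hc, h⟩ := ih
    refine ⟨4 * (2 * (j + 1) + d : ℕ) + 6 + c, by positivity, ?_⟩
    have := lap_qForm_mul ((isHomogeneous_qForm.pow (j + 1)).mul hg)
    rw [pow_succ' qForm (j + 1), mul_assoc, this, h]
    simp only [map_add]
    ring

lemma eq_zero_of_harmonic_qForm_pow_mul (d : ℕ) : ∀ (j : ℕ) (g : MvPolynomial (Fin 3) ℝ),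
    g.IsHomogeneous d → Harmonic (qForm ^ (j + 1) * g) → g = 0 := by
  induction d using Nat.strong_induction_on with
  | _ d ih =>
    intro j g hg hh
    obtain ⟨c, hc, h⟩ := lap_qForm_pow_mul hg j
    rw [show lap _ = 0 from hh] at h
    have h1 : C c * g + qForm * lap g = 0 := by
      refine (mul_eq_zero.mp ?_).resolve_left (pow_ne_zero j qForm_ne_zero)
      rw [h]; ring
    have hCc : (C c⁻¹ * C c : MvPolynomial (Fin 3) ℝ) = 1 := by
      rw [← C_mul, inv_mul_cancel₀ hc.ne', C_1]
    have h2 : g = qForm * (C (-c⁻¹) * lap g) := by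
      rw [C_neg]
      linear_combination (-g) * hCc + C c⁻¹ * h1
    have h3 : (C (-c⁻¹) * lap g).IsHomogeneous (d - 1 - 1) := (isHomogeneous_lap hg).C_mul _
    by_contra hg0
    have hd : 2 + (d - 1 - 1) = d := by
      refine IsHomogeneous.inj_right ?_ hg hg0
      rw [h2]
      exact isHomogeneous_qForm.mul h3
    refine hg0 ?_
    rw [h2, ih _ (by omega) (j + 1) _ h3, mul_zero]
    rwa [pow_succ, mul_assoc, ← h2]

/-- A harmonic polynomial divisible by `x² + y² + z²` vanishes. -/
lemma Harmonic.eq_zero_of_qForm_dvd {p : MvPolynomial (Fin 3) ℝ} (hp : Harmonic p)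
    (hdvd : qForm ∣ p) : p = 0 := by
  obtain ⟨g, rfl⟩ := hdvd
  have hg : g = 0 := by
    rw [← sum_homogeneousComponent g]
    refine Finset.sum_eq_zero fun d _ => ?_
    refine eq_zero_of_harmonic_qForm_pow_mul d 0 _ (homogeneousComponent_isHomogeneous d g) ?_
    rw [zero_add, pow_one, ← homogeneousComponent_mul_add isHomogeneous_qForm]
    exact hp.homogeneousComponent _
  rw [hg, mul_zero]

lemma MvPolynomial.IsHomogeneous.aeval_mul {σ R A : Type*} [CommSemiring R] [CommSemiring A]
    [Algebra R A] {p : MvPolynomial σ R} {m : ℕ} (hp : p.IsHomogeneous m) (c : A) (v : σ → A) :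
    MvPolynomial.aeval (fun i => c * v i) p = c ^ m * MvPolynomial.aeval v p := by
  rw [aeval_def, aeval_def, eval₂_eq, eval₂_eq, Finset.mul_sum]
  refine Finset.sum_congr rfl fun s hs => ?_
  have hdeg := hp.degree_eq_sum_deg_support hs
  simp only [mul_pow, Finset.prod_mul_distrib, Finset.prod_pow_eq_pow_sum]
  rw [hdeg]
  ring

/-- A form of positive degree has a zero on the complex null cone. -/
lemma exists_null_zero {h : MvPolynomial (Fin 3) ℝ} {m : ℕ} (hh : h.IsHomogeneous (m + 1)) :
    ∃ v : Fin 3 → ℂ, v ≠ 0 ∧ v 0 ^ 2 + v 1 ^ 2 + v 2 ^ 2 = 0 ∧ aeval v h = 0 := by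
  have key (f : Fin 3 → Polynomial ℂ) (t : ℂ) :
      (aeval f h).eval t = aeval (fun i => (f i).eval t) h :=
    comp_aeval_apply f ((Polynomial.aeval t).restrictScalars ℝ) h
  have hI : Complex.I ^ 2 = -1 := Complex.I_sq
  let P : Polynomial ℂ := aeval ![1 - Polynomial.X ^ 2,
    Polynomial.C Complex.I * (1 + Polynomial.X ^ 2), 2 * Polynomial.X] h
  have hP (t : ℂ) : P.eval t = aeval ![1 - t ^ 2, Complex.I * (1 + t ^ 2), 2 * t] h := by
    rw [key]
    congr 2
    funext i
    fin_cases i <;> simp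
  let Q : Polynomial ℂ := aeval ![Polynomial.X ^ 2 - 1,
    Polynomial.C Complex.I * (Polynomial.X ^ 2 + 1), 2 * Polynomial.X] h
  have hQ (t : ℂ) : Q.eval t = aeval ![t ^ 2 - 1, Complex.I * (t ^ 2 + 1), 2 * t] h := by
    rw [key]
    congr 2
    funext i
    fin_cases i <;> simp
  by_cases hroot : ∃ t, P.eval t = 0
  · obtain ⟨t, ht⟩ := hroot
    refine ⟨_, ?_, ?_, (hP t).symm.trans ht⟩
    · intro h0
      have h2 := congrFun h0 2
      have h0 := congrFun h0 0
      simp at h2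
      simp [h2] at h0
    · simp
      linear_combination (1 + t ^ 2) ^ 2 * hI
  · have hdeg : P.degree = 0 := by
      by_contra hd
      exact hroot (IsAlgClosed.exists_root P hd)
    obtain ⟨c, hc⟩ : ∃ c, P = Polynomial.C c := ⟨_, Polynomial.eq_C_of_degree_eq_zero hdeg⟩
    have hPQ : Polynomial.X * Q =
        Polynomial.X * (Polynomial.C c * Polynomial.X ^ (2 * (m + 1))) := by
      refine Polynomial.funext fun s => ?_
      by_cases hs : s = 0
      · simp [hs]
      have h1 := hP s⁻¹
      rw [hc, Polynomial.eval_C] at h1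
      simp only [Polynomial.eval_mul, Polynomial.eval_X, Polynomial.eval_C, Polynomial.eval_pow]
      rw [hQ, h1, pow_mul, mul_comm (aeval _ h), ← hh.aeval_mul]
      congr 3
      funext i
      fin_cases i <;> simp <;> field_simp
    have hQ0 : Q.eval 0 = 0 := by
      rw [mul_left_cancel₀ Polynomial.X_ne_zero hPQ]
      simp
    refine ⟨_, ?_, ?_, (hQ 0).symm.trans hQ0⟩
    · intro h0
      simpa using congrFun h0 0
    · simp

/-- A nonzero null vector can be rescaled so that its real and imaginary parts are the first two
rows of an orthogonal matrix. -/
lemma exists_orthogonal_null_zero {h : MvPolynomial (Fin 3) ℝ} {m : ℕ}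
    (hh : h.IsHomogeneous (m + 1)) :
    ∃ M : Matrix (Fin 3) (Fin 3) ℝ, M * M.transpose = 1 ∧
      aeval (fun i => (M 0 i + M 1 i * Complex.I : ℂ)) h = 0 := by
  obtain ⟨v, hv, hq, h0⟩ := exists_null_zero hh
  have hre := congrArg Complex.re hq
  have him := congrArg Complex.im hq
  simp [pow_two] at hre him
  have hr : 0 < (v 0).re ^ 2 + (v 1).re ^ 2 + (v 2).re ^ 2 := by
    have hsum {x y z : ℝ} (hxyz : x ^ 2 + y ^ 2 + z ^ 2 ≤ 0) : x = 0 ∧ y = 0 ∧ z = 0 := by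
      refine ⟨?_, ?_, ?_⟩ <;> nlinarith [sq_nonneg x, sq_nonneg y, sq_nonneg z]
    by_contra hle
    obtain ⟨h1, h2, h3⟩ := hsum (not_lt.mp hle)
    obtain ⟨h4, h5, h6⟩ := hsum (x := (v 0).im) (y := (v 1).im) (z := (v 2).im)
      (by linarith)
    refine hv (funext fun i => ?_)
    fin_cases i
    exacts [Complex.ext h1 h4, Complex.ext h2 h5, Complex.ext h3 h6]
  obtain ⟨s, hs⟩ : ∃ s : ℝ, s ^ 2 * ((v 0).re ^ 2 + (v 1).re ^ 2 + (v 2).re ^ 2) = 1 := by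
    refine ⟨(Real.sqrt ((v 0).re ^ 2 + (v 1).re ^ 2 + (v 2).re ^ 2))⁻¹, ?_⟩
    rw [inv_pow, Real.sq_sqrt hr.le, inv_mul_cancel₀ hr.ne']
  obtain ⟨a, ha⟩ : ∃ a : Fin 3 → ℝ, ∀ i, a i = s * (v i).re := ⟨_, fun _ => rfl⟩
  obtain ⟨b, hb⟩ : ∃ b : Fin 3 → ℝ, ∀ i, b i = s * (v i).im := ⟨_, fun _ => rfl⟩
  have haa : a 0 * a 0 + a 1 * a 1 + a 2 * a 2 = 1 := by
    simp only [ha]; linear_combination hs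
  have hbb : b 0 * b 0 + b 1 * b 1 + b 2 * b 2 = 1 := by
    simp only [hb]; linear_combination hs - s ^ 2 * hre
  have hab : a 0 * b 0 + a 1 * b 1 + a 2 * b 2 = 0 := by
    simp only [ha, hb]; linear_combination s ^ 2 / 2 * him
  refine ⟨Matrix.of ![a, b,
    ![a 1 * b 2 - a 2 * b 1, a 2 * b 0 - a 0 * b 2, a 0 * b 1 - a 1 * b 0]], ?_, ?_⟩
  · ext i j
    fin_cases i <;> fin_cases j <;> simp [Matrix.mul_apply, Fin.sum_univ_three]
    · exact haa
    · exact hab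
    · ring
    · linear_combination hab
    · exact hbb
    · ring
    · ring
    · ring
    · linear_combination haa * (b 0 * b 0 + b 1 * b 1 + b 2 * b 2) + hbb -
        (a 0 * b 0 + a 1 * b 1 + a 2 * b 2) * hab
  · have : (fun i => (a i + b i * Complex.I : ℂ)) = fun i => (s : ℂ) * v i := by
      funext i
      rw [ha, hb]
      push_cast
      conv_rhs => rw [← Complex.re_add_im (v i)]
      ring
    simpa [this, h0] using hh.aeval_mul (s : ℂ) v

/-- The linear form with coefficient vector `a`. -/
noncomputable def linForm (a : Fin 3 → ℝ) : MvPolynomial (Fin 3) ℝ := ∑ i : Fin 3, C (a i) * X i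

lemma isHomogeneous_linForm (a : Fin 3 → ℝ) : (linForm a).IsHomogeneous 1 :=
  IsHomogeneous.sum _ _ _ fun i _ => isHomogeneous_C_mul_X _ i

lemma harmonic_linForm (a : Fin 3 → ℝ) : Harmonic (linForm a) := by
  simp [Harmonic, lap, linForm, Fin.sum_univ_three, pderiv_X, Pi.single_apply]

lemma aeval_linForm {A : Type*} [CommRing A] [Algebra ℝ A] (a : Fin 3 → ℝ) (v : Fin 3 → A) :
    aeval v (linForm a) = algebraMap ℝ A (a 0) * v 0 + algebraMap ℝ A (a 1) * v 1 +
      algebraMap ℝ A (a 2) * v 2 := by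
  simp [linForm, Fin.sum_univ_three]

lemma X_eq_sum_linForm {M : Matrix (Fin 3) (Fin 3) ℝ} (hM : M.transpose * M = 1) (i : Fin 3) :
    X i = ∑ j : Fin 3, C (M j i) * linForm (M j) := by
  have h (k : Fin 3) : ∑ j : Fin 3, M j i * M j k = if i = k then 1 else 0 := by
    simpa [Matrix.mul_apply, Matrix.one_apply] using congrFun (congrFun hM i) k
  simp only [linForm, Finset.mul_sum]
  rw [Finset.sum_comm]
  simp only [← mul_assoc, ← C_mul, ← Finset.sum_mul, ← map_sum, h]
  simp

lemma qForm_eq_sum_linForm_sq {M : Matrix (Fin 3) (Fin 3) ℝ} (hM : M.transpose * M = 1) :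
    qForm = linForm (M 0) ^ 2 + linForm (M 1) ^ 2 + linForm (M 2) ^ 2 := by
  have hX := X_eq_sum_linForm hM
  have : qForm = ∑ i : Fin 3, X i * ∑ j : Fin 3, C (M j i) * linForm (M j) := by
    simp only [← hX, qForm, pow_two]
  rw [this]
  simp only [Fin.sum_univ_three, linForm]
  ring

/-- Division with remainder by `qForm` and `linForm (M 2)`. -/
lemma exists_normal_form {M : Matrix (Fin 3) (Fin 3) ℝ} (hM : M.transpose * M = 1)
    (h : MvPolynomial (Fin 3) ℝ) :
    ∃ (g f : MvPolynomial (Fin 3) ℝ) (A B : Polynomial ℝ),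
      h = qForm * g + linForm (M 2) * f + Polynomial.aeval (linForm (M 0)) A +
        linForm (M 1) * Polynomial.aeval (linForm (M 0)) B := by
  have hq := qForm_eq_sum_linForm_sq hM
  induction h using MvPolynomial.induction_on with
  | C c => exact ⟨0, 0, Polynomial.C c, 0, by simp [algebraMap_eq]⟩
  | add p p' ih ih' =>
    obtain ⟨g, f, A, B, rfl⟩ := ih
    obtain ⟨g', f', A', B', rfl⟩ := ih'
    exact ⟨g + g', f + f', A + A', B + B', by simp only [map_add]; ring⟩
  | mul_X p i ih =>
    obtain ⟨g, f, A, B, hp⟩ := ih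
    refine ⟨X i * g + C (M 1 i) * Polynomial.aeval (linForm (M 0)) B,
      X i * f + C (M 2 i) * (Polynomial.aeval (linForm (M 0)) A +
        linForm (M 1) * Polynomial.aeval (linForm (M 0)) B) -
        C (M 1 i) * linForm (M 2) * Polynomial.aeval (linForm (M 0)) B,
      Polynomial.C (M 0 i) * Polynomial.X * A - Polynomial.C (M 1 i) * Polynomial.X ^ 2 * B,
      Polynomial.C (M 0 i) * Polynomial.X * B + Polynomial.C (M 1 i) * A, ?_⟩
    have hX := X_eq_sum_linForm hM i
    rw [Fin.sum_univ_three] at hX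
    simp only [map_add, map_sub, map_mul, map_pow, Polynomial.aeval_X, Polynomial.aeval_C,
      algebraMap_eq]
    rw [hp]
    linear_combination (Polynomial.aeval (linForm (M 0)) A +
      linForm (M 1) * Polynomial.aeval (linForm (M 0)) B) * hX -
      C (M 1 i) * Polynomial.aeval (linForm (M 0)) B * hq

/-- Modulo `qForm`, every form of positive degree has a real linear factor. -/
lemma exists_linForm_factor {h : MvPolynomial (Fin 3) ℝ} {m : ℕ} (hh : h.IsHomogeneous (m + 1)) :
    ∃ (a : Fin 3 → ℝ) (f : MvPolynomial (Fin 3) ℝ), f.IsHomogeneous m ∧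
      qForm ∣ h - linForm a * f := by
  obtain ⟨M, hM, h0⟩ := exists_orthogonal_null_zero hh
  have hM' := mul_eq_one_comm.mp hM
  obtain ⟨g, f, A, B, hgf⟩ := exists_normal_form hM' h
  have hrow (i j : Fin 3) :
      M i 0 * M j 0 + M i 1 * M j 1 + M i 2 * M j 2 = if i = j then (1 : ℝ) else 0 := by
    simpa [Matrix.mul_apply, Matrix.one_apply, Fin.sum_univ_three] using
      congrFun (congrFun hM i) j
  have hL (x : ℝ) (i : Fin 3) :
      aeval (fun j => (x : ℂ) * (M 0 j + M 1 j * Complex.I : ℂ)) (linForm (M i)) =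
        x * ((if i = 0 then (1 : ℝ) else 0 : ℝ) +
          (if i = 1 then (1 : ℝ) else 0 : ℝ) * Complex.I) := by
    rw [← hrow, ← hrow, aeval_linForm]
    push_cast [Complex.coe_algebraMap]
    ring
  have heval (x : ℝ) : A.eval x = 0 ∧ x * B.eval x = 0 := by
    have hx := hh.aeval_mul (x : ℂ) (fun i => (M 0 i + M 1 i * Complex.I : ℂ))
    rw [h0, mul_zero, hgf, qForm_eq_sum_linForm_sq hM'] at hx
    have hpoly (D : Polynomial ℝ) : Polynomial.aeval (x : ℂ) D = ((D.eval x : ℝ) : ℂ) := by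
      simpa using Polynomial.aeval_algebraMap_apply ℂ x D
    simp only [map_add, map_mul, map_pow, ← Polynomial.aeval_algHom_apply, hL] at hx
    simp [hpoly, mul_pow] at hx
    have hre := congrArg Complex.re hx
    have him := congrArg Complex.im hx
    simp at hre him
    exact ⟨hre, by simpa using him⟩
  have hA : A = 0 := Polynomial.funext fun x => by simpa using (heval x).1
  have hB : B = 0 := by
    have : Polynomial.X * B = 0 := Polynomial.funext fun x => by simpa using (heval x).2
    exact (mul_eq_zero.mp this).resolve_left Polynomial.X_ne_zero
  refine ⟨M 2, homogeneousComponent m f, homogeneousComponent_isHomogeneous m f, ?_⟩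
  have hdvd : qForm ∣ h - linForm (M 2) * f := ⟨g, by rw [hgf, hA, hB]; simp⟩
  have := qForm_dvd_homogeneousComponent hdvd (1 + m)
  rwa [map_sub, homogeneousComponent_mul_add (isHomogeneous_linForm _),
    homogeneousComponent_eq_self (by rwa [add_comm])] at this

/-- Modulo `qForm`, every form of degree `n + m` has a harmonic factor of degree `n`. -/
lemma IsHarmonicProduct.exists_harmonic_factor
    {star : MvPolynomial (Fin 3) ℝ → MvPolynomial (Fin 3) ℝ → MvPolynomial (Fin 3) ℝ}
    (hstar : IsHarmonicProduct star) (n : ℕ) : ∀ (m : ℕ) (h : MvPolynomial (Fin 3) ℝ),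
    h.IsHomogeneous (n + m) → ∃ p f : MvPolynomial (Fin 3) ℝ, Harmonic p ∧ p.IsHomogeneous n ∧
      f.IsHomogeneous m ∧ qForm ∣ h - p * f := by
  induction n with
  | zero =>
    intro m h hh
    exact ⟨1, h, harmonic_one, isHomogeneous_one _ _, by simpa using hh, by simp⟩
  | succ n ih =>
    intro m h hh
    obtain ⟨p, f, hp, hpn, hf, hdvd⟩ := ih (m + 1) h (by convert hh using 1; ring)
    obtain ⟨a, f', hf', hdvd'⟩ := exists_linForm_factor hf
    obtain ⟨hs, hsdvd⟩ := hstar p (linForm a) hp (harmonic_linForm a)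
    have hcomp := qForm_dvd_homogeneousComponent hsdvd (n + 1)
    rw [map_sub, homogeneousComponent_eq_self (hpn.mul (isHomogeneous_linForm a))] at hcomp
    refine ⟨homogeneousComponent (n + 1) (star p (linForm a)), f', hs.homogeneousComponent _,
      homogeneousComponent_isHomogeneous _ _, hf', ?_⟩
    have : h - homogeneousComponent (n + 1) (star p (linForm a)) * f' =
        (h - p * f) + p * (f - linForm a * f') +
          (p * linForm a - homogeneousComponent (n + 1) (star p (linForm a))) * f' := by ring
    rw [this]
    exact dvd_add (dvd_add hdvd (hdvd'.mul_left p)) (hcomp.mul_right f')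

/-- Modulo `qForm`, every form of degree `(k + 1) * n` is a harmonic product of `k + 1` harmonic
forms of degree `n`. -/
lemma IsHarmonicProduct.exists_factorization_mod
    {star : MvPolynomial (Fin 3) ℝ → MvPolynomial (Fin 3) ℝ → MvPolynomial (Fin 3) ℝ}
    (hstar : IsHarmonicProduct star) (n k : ℕ) : ∀ h : MvPolynomial (Fin 3) ℝ,
    h.IsHomogeneous ((k + 1) * n) → ∃ hs : Fin (k + 1) → MvPolynomial (Fin 3) ℝ,
      (∀ i, Harmonic (hs i) ∧ (hs i).IsHomogeneous n) ∧
        Harmonic ((List.ofFn hs).foldr star 1) ∧ qForm ∣ h - (List.ofFn hs).foldr star 1 := by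
  induction k with
  | zero =>
    intro h hh
    obtain ⟨p, f, hp, hpn, hf, hdvd⟩ := hstar.exists_harmonic_factor n 0 h (by simpa using hh)
    obtain ⟨c, rfl⟩ : ∃ c, f = C c :=
      ⟨_, totalDegree_eq_zero_iff_eq_C.mp ((totalDegree_zero_iff_isHomogeneous _).mpr hf)⟩
    obtain ⟨h1, h2⟩ := hstar (C c * p) 1 (hp.C_mul c) harmonic_one
    refine ⟨fun _ => C c * p, fun _ => ⟨hp.C_mul c, hpn.C_mul c⟩, by simpa using h1, ?_⟩
    have := dvd_add hdvd h2
    rw [mul_one, mul_comm p, sub_add_sub_cancel] at this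
    simpa using this
  | succ k ih =>
    intro h hh
    obtain ⟨p, f, hp, hpn, hf, hdvd⟩ :=
      hstar.exists_harmonic_factor n ((k + 1) * n) h (by convert hh using 1; ring)
    obtain ⟨hs, hhs, hharm, hdvd'⟩ := ih f hf
    obtain ⟨h1, h2⟩ := hstar p _ hp hharm
    refine ⟨Fin.cons p hs, Fin.cases ⟨hp, hpn⟩ hhs, ?_, ?_⟩
    · simpa [List.ofFn_succ] using h1
    · have := dvd_add (dvd_add hdvd (hdvd'.mul_left p)) h2
      rw [mul_sub, sub_add_sub_cancel, sub_add_sub_cancel] at this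
      simpa [List.ofFn_succ] using this

/-- **Harmonic factorization theorem**: every harmonic homogeneous polynomial of degree
`k·n` on `ℝ³` (`k ≥ 1`) is a harmonic product `h₁ ∗ ⋯ ∗ h_k` of `k` harmonic homogeneous
polynomials of degree `n`. -/
theorem harmonic_factorization (star : MvPolynomial (Fin 3) ℝ → MvPolynomial (Fin 3) ℝ →
      MvPolynomial (Fin 3) ℝ) (hstar : IsHarmonicProduct star)
    (k n : ℕ) (hk : 1 ≤ k) (h : MvPolynomial (Fin 3) ℝ)
    (hharm : Harmonic h) (hhom : h.IsHomogeneous (k * n)) :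
    ∃ hs : Fin k → MvPolynomial (Fin 3) ℝ,
      (∀ i, Harmonic (hs i) ∧ (hs i).IsHomogeneous n) ∧
        h = (List.ofFn hs).foldr star 1 := by
  obtain ⟨k, rfl⟩ := Nat.exists_eq_add_of_le' hk
  obtain ⟨hs, hhs, hfold, hdvd⟩ := hstar.exists_factorization_mod n k h hhom
  exact ⟨hs, hhs, sub_eq_zero.mp ((hharm.sub hfold).eq_zero_of_qForm_dvd hdvd)⟩
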